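/- arXiv:1912.06989 — 2 statements merged into one kernel-verified Lean document; each statement's English description precedes it below -/
import Mathlib

section
/- Let K ∈ ℝ^{n×n} be symmetric positive semidefinite with eigenvalues λ_1 ≥ ··· ≥ λ_n ≥ 0, let 0 < p ≤ 1, and let W = diag(w_1, …, w_n) with 0 ≤ w_1 ≤ w_2 ≤ ··· ≤ w_n. Then min over orthogonal matrices Q ∈ ℝ^{n×n} of Tr((W^{1/p} Qᵀ K Q W^{1/p})^{p/2}) equals Σ_{i=1}^n w_i λ_i^{p/2}, and the minimum is attained when the columns of Q are eigenvectors of K ordered by decreasing eigenvalue. -/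
open scoped Matrix

/-- `Tr(A^r)` for a symmetric PSD matrix, defined spectrally as the sum of the `r`-th
powers of the eigenvalues. -/
noncomputable def trRpow {n : ℕ} (A : Matrix (Fin n) (Fin n) ℝ) (r : ℝ) : ℝ :=
  if h : A.IsHermitian then ∑ i, (h.eigenvalues i) ^ r else 0

open MeasureTheory Set in
lemma integrableOn_log_one_add_mul_rpow {r : ℝ} (hr0 : 0 < r) (hr1 : r < 1) :
    IntegrableOn (fun s : ℝ => Real.log (1 + s) * s ^ (-r - 1)) (Ioi 0) := by
  have hmeas : Measurable fun s : ℝ => Real.log (1 + s) * s ^ (-r - 1) := by fun_prop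
  rw [← Ioc_union_Ioi_eq_Ioi zero_le_one]
  refine IntegrableOn.union ?_ ?_
  · have hint : IntegrableOn (fun s : ℝ => s ^ (-r)) (Ioc 0 1) := by
      rw [integrableOn_Ioc_iff_integrableOn_Ioo]
      exact (intervalIntegral.integrableOn_Ioo_rpow_iff one_pos).2 (by linarith)
    refine Integrable.mono' hint hmeas.aestronglyMeasurable ?_
    filter_upwards [ae_restrict_mem measurableSet_Ioc] with s hs
    have hs0 : 0 < s := hs.1
    have hlog0 : 0 ≤ Real.log (1 + s) := Real.log_nonneg (by linarith)
    rw [Real.norm_of_nonneg (by positivity)]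
    have hlog : Real.log (1 + s) ≤ s := by
      linarith [Real.log_le_sub_one_of_pos (show 0 < 1 + s by linarith)]
    calc Real.log (1 + s) * s ^ (-r - 1) ≤ s * s ^ (-r - 1) := by gcongr
      _ = s ^ (-r) := by
        rw [Real.rpow_sub_one hs0.ne']
        field_simp
  · have hint : IntegrableOn (fun s : ℝ => 2 ^ (r / 2) / (r / 2) * s ^ (-(r / 2) - 1)) (Ioi 1) :=
      (integrableOn_Ioi_rpow_of_lt (by linarith) one_pos).const_mul _
    refine Integrable.mono' hint hmeas.aestronglyMeasurable ?_
    filter_upwards [ae_restrict_mem measurableSet_Ioi] with s hs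
    have hs1 : 1 < s := hs
    have hs0 : 0 < s := by linarith
    have hlog0 : 0 ≤ Real.log (1 + s) := Real.log_nonneg (by linarith)
    rw [Real.norm_of_nonneg (by positivity)]
    calc Real.log (1 + s) * s ^ (-r - 1)
        ≤ ((2 * s) ^ (r / 2) / (r / 2)) * s ^ (-r - 1) := by
          gcongr
          refine (Real.log_le_rpow_div (by positivity) (half_pos hr0)).trans ?_
          gcongr
          linarith
      _ = 2 ^ (r / 2) / (r / 2) * s ^ (-(r / 2) - 1) := by
          rw [Real.mul_rpow (by norm_num) hs0.le,
            show -(r / 2) - 1 = r / 2 + (-r - 1) by ring, Real.rpow_add hs0]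
          ring

open MeasureTheory Set in
lemma integral_log_one_add_mul_rpow_pos {r : ℝ} (hr0 : 0 < r) (hr1 : r < 1) :
    0 < ∫ s in Ioi (0 : ℝ), Real.log (1 + s) * s ^ (-r - 1) := by
  have hpos : ∀ s ∈ Ioi (0 : ℝ), 0 < Real.log (1 + s) * s ^ (-r - 1) := fun s hs =>
    mul_pos (Real.log_pos (by linarith [mem_Ioi.1 hs])) (Real.rpow_pos_of_pos hs _)
  rw [setIntegral_pos_iff_support_of_nonneg_ae _ (integrableOn_log_one_add_mul_rpow hr0 hr1)]
  · rw [inter_eq_right.2 fun s hs => Function.mem_support.2 (hpos s hs).ne']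
    simp
  · filter_upwards [ae_restrict_mem measurableSet_Ioi] with s hs using (hpos s hs).le

lemma log_one_add_mul_mul_rpow_eq {r u s : ℝ} (hu : 0 < u) (hs : 0 < s) :
    Real.log (1 + s * u) * s ^ (-r - 1) =
      u ^ (r + 1) * (Real.log (1 + u * s) * (u * s) ^ (-r - 1)) := by
  rw [Real.mul_rpow hu.le hs.le, show -r - 1 = -(r + 1) by ring, Real.rpow_neg hu.le, mul_comm u s]
  have := (Real.rpow_pos_of_pos hu (r + 1)).ne'
  field_simp

open MeasureTheory Set in
lemma integrableOn_log_one_add_mul_mul_rpow {r u : ℝ} (hr0 : 0 < r) (hr1 : r < 1) (hu : 0 ≤ u) :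
    IntegrableOn (fun s : ℝ => Real.log (1 + s * u) * s ^ (-r - 1)) (Ioi 0) := by
  rcases hu.eq_or_lt with rfl | hu
  · simp
  · refine (integrableOn_congr_fun (s := Ioi 0)
      (fun s hs => log_one_add_mul_mul_rpow_eq hu hs) measurableSet_Ioi).2 ?_
    refine Integrable.const_mul ?_ _
    refine (integrableOn_Ioi_comp_mul_left_iff
      (fun s : ℝ => Real.log (1 + s) * s ^ (-r - 1)) 0 hu).2 ?_
    simpa using integrableOn_log_one_add_mul_rpow hr0 hr1

open MeasureTheory Set in
lemma integral_log_one_add_mul_mul_rpow {r u : ℝ} (hr0 : 0 < r) (hu : 0 ≤ u) :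
    ∫ s in Ioi (0 : ℝ), Real.log (1 + s * u) * s ^ (-r - 1) =
      u ^ r * ∫ s in Ioi (0 : ℝ), Real.log (1 + s) * s ^ (-r - 1) := by
  rcases hu.eq_or_lt with rfl | hu
  · simp [Real.zero_rpow hr0.ne']
  · rw [setIntegral_congr_fun measurableSet_Ioi
      (fun s hs => log_one_add_mul_mul_rpow_eq hu hs), integral_const_mul,
      integral_comp_mul_left_Ioi (fun s : ℝ => Real.log (1 + s) * s ^ (-r - 1)) 0 hu,
      mul_zero, smul_eq_mul, ← mul_assoc, Real.rpow_add_one hu.ne']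
    field_simp

open MeasureTheory Set in
/-- Comparison of power sums through the polynomials `∏ (1 + s μᵢ)`, by integrating
`log (1 + s u)` against `s ^ (-r - 1)`. -/
lemma sum_rpow_le_sum_rpow_of_prod_one_add_le {ι : Type*} [Fintype ι] {r : ℝ}
    (hr0 : 0 < r) (hr1 : r < 1) {μ ν : ι → ℝ} (hμ : ∀ i, 0 ≤ μ i) (hν : ∀ i, 0 ≤ ν i)
    (h : ∀ s : ℝ, 0 < s → ∏ i, (1 + s * μ i) ≤ ∏ i, (1 + s * ν i)) :
    ∑ i, μ i ^ r ≤ ∑ i, ν i ^ r := by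
  have hsum : ∀ x : ι → ℝ, (∀ i, 0 ≤ x i) →
      ∫ s in Ioi (0 : ℝ), ∑ i, Real.log (1 + s * x i) * s ^ (-r - 1) =
        (∑ i, x i ^ r) * ∫ s in Ioi (0 : ℝ), Real.log (1 + s) * s ^ (-r - 1) := by
    intro x hx
    rw [integral_finsetSum _ fun i _ => integrableOn_log_one_add_mul_mul_rpow hr0 hr1 (hx i),
      Finset.sum_mul]
    exact Finset.sum_congr rfl fun i _ => integral_log_one_add_mul_mul_rpow hr0 (hx i)
  refine le_of_mul_le_mul_right ?_ (integral_log_one_add_mul_rpow_pos hr0 hr1)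
  rw [← hsum μ hμ, ← hsum ν hν]
  refine setIntegral_mono_on
    (integrable_finsetSum _ fun i _ => integrableOn_log_one_add_mul_mul_rpow hr0 hr1 (hμ i))
    (integrable_finsetSum _ fun i _ => integrableOn_log_one_add_mul_mul_rpow hr0 hr1 (hν i))
    measurableSet_Ioi fun s hs => ?_
  have hs0 : 0 < s := hs
  have hfac : ∀ x : ι → ℝ, (∀ i, 0 ≤ x i) → ∀ i, 0 < 1 + s * x i := fun x hx i => by
    have := hx i
    positivity
  rw [← Finset.sum_mul, ← Finset.sum_mul, ← Real.log_prod fun i _ => (hfac μ hμ i).ne',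
    ← Real.log_prod fun i _ => (hfac ν hν i).ne']
  exact mul_le_mul_of_nonneg_right
    (Real.log_le_log (Finset.prod_pos fun i _ => hfac μ hμ i) (h s hs0)) (by positivity)

/-- The trace inequality `∑ tᵢ xᵢ ≤ Tr (diag t · P · diag x · Pᵀ)` for orthogonal `P` and
oppositely ordered `t`, `x`. -/
lemma sum_mul_le_trace_of_antivary {ι : Type*} [Fintype ι] [DecidableEq ι]
    {P : Matrix ι ι ℝ} (hP : Pᵀ * P = 1) (hP' : P * Pᵀ = 1) {t x : ι → ℝ} (h : Antivary t x) :
    ∑ i, t i * x i ≤ (Matrix.diagonal t * (P * Matrix.diagonal x * Pᵀ)).trace := by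
  have hds : Matrix.of (fun i j => P i j ^ 2) ∈ doublyStochastic ℝ ι := by
    refine mem_doublyStochastic_iff_sum.2 ⟨fun i j => sq_nonneg _, fun i => ?_, fun j => ?_⟩
    · have := congr_fun (congr_fun hP' i) i
      simpa [Matrix.mul_apply, sq] using this
    · have := congr_fun (congr_fun hP j) j
      simpa [Matrix.mul_apply, sq] using this
  obtain ⟨c, hc0, hc1, hc⟩ := exists_eq_sum_perm_of_mem_doublyStochastic hds
  have hPsq : ∀ i j, P i j ^ 2 = ∑ σ : Equiv.Perm ι, c σ * if σ i = j then 1 else 0 := by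
    intro i j
    have := congr_fun (congr_fun hc i) j
    rw [Matrix.of_apply] at this
    rw [← this, Matrix.sum_apply]
    simp [Equiv.Perm.permMatrix, PEquiv.toMatrix_apply, eq_comm]
  calc ∑ i, t i * x i = ∑ σ : Equiv.Perm ι, c σ * ∑ i, t i * x i := by
        rw [← Finset.sum_mul, hc1, one_mul]
    _ ≤ ∑ σ : Equiv.Perm ι, c σ * ∑ i, t i * x (σ i) :=
        Finset.sum_le_sum fun σ _ =>
          mul_le_mul_of_nonneg_left h.sum_mul_le_sum_mul_comp_perm (hc0 σ)
    _ = ∑ i, ∑ j, t i * (P i j ^ 2 * x j) := by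
        simp_rw [hPsq, Finset.mul_sum, Finset.sum_mul, Finset.mul_sum]
        rw [Finset.sum_comm]
        refine Finset.sum_congr rfl fun i _ => ?_
        rw [Finset.sum_comm]
        refine Finset.sum_congr rfl fun σ _ => ?_
        simp
        ring
    _ = _ := by
        rw [Matrix.trace]
        simp only [Matrix.diag_apply, Matrix.diagonal_mul]
        simp only [Matrix.mul_apply (M := P * _), Matrix.mul_diagonal, Matrix.transpose_apply,
          Finset.mul_sum]
        refine Finset.sum_congr rfl fun i _ => Finset.sum_congr rfl fun j _ => ?_
        ring

lemma Matrix.PosDef.exists_orthogonal_diagonalization_antitone {n : ℕ}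
    {Z : Matrix (Fin n) (Fin n) ℝ} (hZ : Z.PosDef) :
    ∃ (U : Matrix (Fin n) (Fin n) ℝ) (z : Fin n → ℝ), Uᵀ * U = 1 ∧ U * Uᵀ = 1 ∧ Antitone z ∧
      (∀ i, 0 < z i) ∧ Z = U * Matrix.diagonal z * Uᵀ := by
  let e := hZ.1.eigenvalues
  let τ : Equiv.Perm (Fin n) := Tuple.sort (fun i => -e i)
  let E : Matrix (Fin n) (Fin n) ℝ := hZ.1.eigenvectorUnitary
  have hE : Eᵀ * E = 1 := by
    simpa [Matrix.star_eq_conjTranspose] using Unitary.coe_star_mul_self hZ.1.eigenvectorUnitary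
  have hspec : Z = E * Matrix.diagonal e * Eᵀ := by
    have := hZ.1.spectral_theorem
    rw [Unitary.conjStarAlgAut_apply] at this
    simpa [Matrix.star_eq_conjTranspose] using this
  have hU : (E.submatrix id τ)ᵀ * E.submatrix id τ = 1 := by
    rw [Matrix.transpose_submatrix, ← Matrix.submatrix_mul _ _ _ _ _ Function.bijective_id, hE,
      Matrix.submatrix_one_equiv]
  refine ⟨E.submatrix id τ, e ∘ τ, hU, mul_eq_one_comm.1 hU, fun i j hij => ?_,
    fun i => hZ.eigenvalues_pos _, ?_⟩
  · have := Tuple.monotone_sort (fun i => -e i) hij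
    simpa using this
  · rw [← Matrix.submatrix_diagonal_equiv, Matrix.transpose_submatrix,
      Matrix.submatrix_mul_equiv, Matrix.submatrix_mul_equiv, ← hspec, Matrix.submatrix_id_id]

/-- Fiedler's lower bound for the determinant of a sum of two positive semidefinite matrices, in
multiplicative form and for positive weights. -/
lemma prod_one_add_le_det_of_pos {n : ℕ} {R : Matrix (Fin n) (Fin n) ℝ}
    (hR : Rᵀ * R = 1) (hR' : R * Rᵀ = 1) {d l : Fin n → ℝ} (hd : ∀ i, 0 < d i)
    (hdm : Monotone d) (hl : ∀ i, 0 ≤ l i) (hla : Antitone l) :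
    ∏ i, (1 + d i * l i) ≤
      (1 + Matrix.diagonal d * (R * Matrix.diagonal l * Rᵀ)).det := by
  have hZ : (Matrix.diagonal (fun i => (d i)⁻¹) + R * Matrix.diagonal l * Rᵀ).PosDef := by
    refine (Matrix.PosDef.diagonal fun i => inv_pos.2 (hd i)).add_posSemidef ?_
    simpa using (Matrix.posSemidef_diagonal_iff.2 hl).mul_mul_conjTranspose_same R
  obtain ⟨U, z, hU, hU', hz, hz0, hUz⟩ := hZ.exists_orthogonal_diagonalization_antitone
  have hfactor : 1 + Matrix.diagonal d * (R * Matrix.diagonal l * Rᵀ) =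
      Matrix.diagonal d * (U * Matrix.diagonal z * Uᵀ) := by
    rw [← hUz, mul_add, Matrix.diagonal_mul_diagonal]
    simp [(hd _).ne']
  have hdetU : U.det * Uᵀ.det = 1 := by rw [← Matrix.det_mul, hU', Matrix.det_one]
  have hdet : (U * Matrix.diagonal z * Uᵀ).det = ∏ i, z i := by
    rw [Matrix.det_mul, Matrix.det_mul, Matrix.det_diagonal, mul_right_comm, hdetU, one_mul]
  let u : Fin n → ℝ := fun i => (d i)⁻¹ + l i
  have hu : ∀ i, 0 < u i := fun i => add_pos_of_pos_of_nonneg (inv_pos.2 (hd i)) (hl i)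
  have hti : Monotone fun i => (z i)⁻¹ := fun i j hij => inv_anti₀ (hz0 j) (hz hij)
  have hdi : Antitone fun i => (d i)⁻¹ := fun i j hij => inv_anti₀ (hd i) (hdm hij)
  have htrace : ∑ i, (z i)⁻¹ * u i ≤ n := by
    have hX := sum_mul_le_trace_of_antivary (P := Uᵀ) (by simpa using hU') (by simpa using hU)
      (hti.antivary hdi)
    have hY := sum_mul_le_trace_of_antivary (P := Uᵀ * R)
      (by rw [Matrix.transpose_mul, Matrix.transpose_transpose, mul_assoc, ← mul_assoc U, hU',
        one_mul, hR])
      (by rw [Matrix.transpose_mul, Matrix.transpose_transpose, mul_assoc, ← mul_assoc R, hR',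
        one_mul, hU])
      (hti.antivary hla)
    have hsum : Matrix.diagonal (fun i => (z i)⁻¹) *
          (Uᵀ * Matrix.diagonal (fun i => (d i)⁻¹) * Uᵀᵀ) +
        Matrix.diagonal (fun i => (z i)⁻¹) *
          (Uᵀ * R * Matrix.diagonal l * (Uᵀ * R)ᵀ) = 1 := by
      calc _ = Matrix.diagonal (fun i => (z i)⁻¹) *
            (Uᵀ * (Matrix.diagonal (fun i => (d i)⁻¹) + R * Matrix.diagonal l * Rᵀ) * U) := by
            simp only [Matrix.transpose_mul, Matrix.transpose_transpose]
            noncomm_ring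
        _ = Matrix.diagonal (fun i => (z i)⁻¹) *
            ((Uᵀ * U) * Matrix.diagonal z * (Uᵀ * U)) := by
            rw [hUz]
            noncomm_ring
        _ = 1 := by
            rw [hU, one_mul, mul_one, Matrix.diagonal_mul_diagonal]
            simp [(hz0 _).ne']
    have htr := congr_arg Matrix.trace hsum
    rw [Matrix.trace_add, Matrix.trace_one, Fintype.card_fin] at htr
    simp only [u, mul_add, Finset.sum_add_distrib]
    linarith
  have hprod : ∏ i, u i ≤ ∏ i, z i := by
    rw [← Real.log_le_log_iff (Finset.prod_pos fun i _ => hu i)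
      (Finset.prod_pos fun i _ => hz0 i), Real.log_prod fun i _ => (hu i).ne',
      Real.log_prod fun i _ => (hz0 i).ne', ← sub_nonpos, ← Finset.sum_sub_distrib]
    calc ∑ i, (Real.log (u i) - Real.log (z i)) ≤ ∑ i, ((z i)⁻¹ * u i - 1) := by
          refine Finset.sum_le_sum fun i _ => ?_
          rw [← Real.log_div (hu i).ne' (hz0 i).ne', div_eq_inv_mul]
          exact Real.log_le_sub_one_of_pos (mul_pos (inv_pos.2 (hz0 i)) (hu i))
      _ ≤ 0 := by
          rw [Finset.sum_sub_distrib]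
          simpa using htrace
  rw [hfactor, Matrix.det_mul, hdet, Matrix.det_diagonal]
  calc ∏ i, (1 + d i * l i) = (∏ i, d i) * ∏ i, u i := by
        rw [← Finset.prod_mul_distrib]
        refine Finset.prod_congr rfl fun i _ => ?_
        simp only [u]
        rw [mul_add, mul_inv_cancel₀ (hd i).ne']
    _ ≤ _ := mul_le_mul_of_nonneg_left hprod (Finset.prod_nonneg fun i _ => (hd i).le)

open Filter Topology in
lemma prod_one_add_le_det {n : ℕ} {R : Matrix (Fin n) (Fin n) ℝ}
    (hR : Rᵀ * R = 1) (hR' : R * Rᵀ = 1) {d l : Fin n → ℝ} (hd : ∀ i, 0 ≤ d i)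
    (hdm : Monotone d) (hl : ∀ i, 0 ≤ l i) (hla : Antitone l) :
    ∏ i, (1 + d i * l i) ≤
      (1 + Matrix.diagonal d * (R * Matrix.diagonal l * Rᵀ)).det := by
  have hleft : Continuous fun ε : ℝ => ∏ i, (1 + (d i + ε) * l i) := by fun_prop
  have hright : Continuous fun ε : ℝ =>
      (1 + Matrix.diagonal (fun i => d i + ε) * (R * Matrix.diagonal l * Rᵀ)).det := by
    fun_prop
  have key := le_of_tendsto_of_tendsto
    ((hleft.tendsto 0).mono_left (nhdsWithin_le_nhds (s := Set.Ioi 0)))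
    ((hright.tendsto 0).mono_left (nhdsWithin_le_nhds (s := Set.Ioi 0)))
    (by
      filter_upwards [self_mem_nhdsWithin] with ε hε
      have hε0 : 0 < ε := hε
      exact prod_one_add_le_det_of_pos hR hR' (fun i => by linarith [hd i])
        (fun i j hij => by simpa using hdm hij) hl hla)
  simpa using key

lemma Matrix.IsHermitian.det_one_add_smul {n : ℕ} {A : Matrix (Fin n) (Fin n) ℝ}
    (hA : A.IsHermitian) (s : ℝ) : (1 + s • A).det = ∏ i, (1 + s * hA.eigenvalues i) := by
  let E : Matrix (Fin n) (Fin n) ℝ := hA.eigenvectorUnitary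
  have hE : Eᵀ * E = 1 := by
    simpa [Matrix.star_eq_conjTranspose] using Unitary.coe_star_mul_self hA.eigenvectorUnitary
  have hspec : A = E * Matrix.diagonal hA.eigenvalues * Eᵀ := by
    have := hA.spectral_theorem
    rw [Unitary.conjStarAlgAut_apply] at this
    simpa [Matrix.star_eq_conjTranspose] using this
  have hswap : (1 + s • A).det = (1 + s • Matrix.diagonal hA.eigenvalues).det := by
    conv_lhs => rw [hspec, mul_assoc, ← Matrix.mul_smul, Matrix.det_one_add_mul_comm,
      Matrix.smul_mul, mul_assoc, hE, mul_one]
  rw [hswap, ← Matrix.diagonal_smul, ← Matrix.diagonal_one, Matrix.diagonal_add,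
    Matrix.det_diagonal]
  simp

lemma sum_rpow_le_trRpow {n : ℕ} {A : Matrix (Fin n) (Fin n) ℝ} (hA : A.PosSemidef) {r : ℝ}
    (hr0 : 0 < r) (hr1 : r < 1) {μ : Fin n → ℝ} (hμ : ∀ i, 0 ≤ μ i)
    (h : ∀ s : ℝ, 0 < s → ∏ i, (1 + s * μ i) ≤ (1 + s • A).det) :
    ∑ i, μ i ^ r ≤ trRpow A r := by
  rw [trRpow, dif_pos hA.1]
  exact sum_rpow_le_sum_rpow_of_prod_one_add_le hr0 hr1 hμ hA.eigenvalues_nonneg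
    fun s hs => (h s hs).trans_eq (hA.1.det_one_add_smul s)

lemma trRpow_diagonal {n : ℕ} {r : ℝ} (hr0 : 0 < r) (hr1 : r < 1) {μ : Fin n → ℝ}
    (hμ : ∀ i, 0 ≤ μ i) : trRpow (Matrix.diagonal μ) r = ∑ i, μ i ^ r := by
  have hA : (Matrix.diagonal μ).PosSemidef := Matrix.posSemidef_diagonal_iff.2 hμ
  have hdet : ∀ s : ℝ, (1 + s • Matrix.diagonal μ).det = ∏ i, (1 + s * μ i) := fun s => by
    rw [← Matrix.diagonal_smul, ← Matrix.diagonal_one, Matrix.diagonal_add, Matrix.det_diagonal]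
    simp
  refine le_antisymm ?_ (sum_rpow_le_trRpow hA hr0 hr1 hμ fun s _ => (hdet s).ge)
  rw [trRpow, dif_pos hA.1]
  exact sum_rpow_le_sum_rpow_of_prod_one_add_le hr0 hr1 hA.eigenvalues_nonneg hμ
    fun s _ => ((hA.1.det_one_add_smul s).symm.trans (hdet s)).le

/-- for symmetric PSD `K` with eigenvalues `λ₁ ≥ ⋯ ≥ λₙ ≥ 0` and weights
`0 ≤ w₁ ≤ ⋯ ≤ wₙ`, the minimum over orthogonal `Q` of
`Tr((W^{1/p} Qᵀ K Q W^{1/p})^{p/2})` equals `Σ w_i λ_i^{p/2}`, attained at the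
eigenvector matrix `Q = V`. -/
theorem stmt6 (n : ℕ) (p : ℝ) (hp0 : 0 < p) (hp1 : p ≤ 1)
    (K : Matrix (Fin n) (Fin n) ℝ) (hK : K.PosSemidef)
    (V : Matrix (Fin n) (Fin n) ℝ) (lam : Fin n → ℝ)
    (hV : Vᵀ * V = 1) (hV' : V * Vᵀ = 1) (hVK : K = V * Matrix.diagonal lam * Vᵀ)
    (hlamsort : Antitone lam) (hlampos : ∀ i, 0 ≤ lam i)
    (w : Fin n → ℝ) (hwpos : ∀ i, 0 ≤ w i) (hwsort : Monotone w) :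
    IsLeast
      {t : ℝ | ∃ Q : Matrix (Fin n) (Fin n) ℝ, Qᵀ * Q = 1 ∧ Q * Qᵀ = 1 ∧
        t = trRpow (Matrix.diagonal (fun i => w i ^ (1 / p)) * Qᵀ * K * Q *
              Matrix.diagonal (fun i => w i ^ (1 / p))) (p / 2)}
      (∑ i, w i * lam i ^ (p / 2)) ∧
    trRpow (Matrix.diagonal (fun i => w i ^ (1 / p)) * Vᵀ * K * V *
        Matrix.diagonal (fun i => w i ^ (1 / p))) (p / 2)
      = ∑ i, w i * lam i ^ (p / 2) := by
  have hr0 : 0 < p / 2 := by linarith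
  have hr1 : p / 2 < 1 := by linarith
  have ha : ∀ i, 0 ≤ w i ^ (1 / p) := fun i => Real.rpow_nonneg (hwpos i) _
  have ham : Monotone fun i => w i ^ (1 / p) := fun i j hij =>
    Real.rpow_le_rpow (hwpos i) (hwsort hij) (by positivity)
  have hμ : ∀ i, 0 ≤ w i ^ (1 / p) * w i ^ (1 / p) * lam i := fun i =>
    mul_nonneg (mul_nonneg (ha i) (ha i)) (hlampos i)
  have hpow : ∑ i, (w i ^ (1 / p) * w i ^ (1 / p) * lam i) ^ (p / 2) =
      ∑ i, w i * lam i ^ (p / 2) := by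
    refine Finset.sum_congr rfl fun i _ => ?_
    rw [Real.mul_rpow (mul_nonneg (ha i) (ha i)) (hlampos i), Real.mul_rpow (ha i) (ha i),
      ← Real.rpow_add_of_nonneg (ha i) hr0.le hr0.le, ← Real.rpow_mul (hwpos i),
      add_halves, one_div_mul_cancel hp0.ne', Real.rpow_one]
  have hval : trRpow (Matrix.diagonal (fun i => w i ^ (1 / p)) * Vᵀ * K * V *
        Matrix.diagonal (fun i => w i ^ (1 / p))) (p / 2) = ∑ i, w i * lam i ^ (p / 2) := by
    have hdiag : Matrix.diagonal (fun i => w i ^ (1 / p)) * Vᵀ * K * V *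
        Matrix.diagonal (fun i => w i ^ (1 / p)) =
        Matrix.diagonal (fun i => w i ^ (1 / p) * w i ^ (1 / p) * lam i) := by
      calc _ = Matrix.diagonal (fun i => w i ^ (1 / p)) * (Vᵀ * V) * Matrix.diagonal lam *
            (Vᵀ * V) * Matrix.diagonal (fun i => w i ^ (1 / p)) := by
            rw [hVK]
            noncomm_ring
        _ = _ := by
            rw [hV, mul_one, mul_one, Matrix.diagonal_mul_diagonal, Matrix.diagonal_mul_diagonal]
            congr 1
            funext i
            ring
    rw [hdiag, trRpow_diagonal hr0 hr1 hμ, hpow]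
  refine ⟨⟨⟨V, hV, hV', hval.symm⟩, ?_⟩, hval⟩
  rintro _ ⟨Q, hQ, hQ', rfl⟩
  rw [← hpow]
  refine sum_rpow_le_trRpow ?_ hr0 hr1 hμ fun s hs => ?_
  · simpa [Matrix.conjTranspose_mul, mul_assoc] using
      hK.conjTranspose_mul_mul_same (Q * Matrix.diagonal fun i => w i ^ (1 / p))
  · have hR : (Qᵀ * V)ᵀ * (Qᵀ * V) = 1 := by
      rw [Matrix.transpose_mul, Matrix.transpose_transpose, mul_assoc, ← mul_assoc Q, hQ',
        one_mul, hV]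
    have key := prod_one_add_le_det hR (mul_eq_one_comm.1 hR)
      (fun i => mul_nonneg (ha i) (ha i)) (ham.mul ham ha ha)
      (fun i => mul_nonneg hs.le (hlampos i)) (fun i j hij =>
        mul_le_mul_of_nonneg_left (hlamsort hij) hs.le)
    have hlam : Matrix.diagonal (fun i => s * lam i) = s • Matrix.diagonal lam := by
      rw [← Matrix.diagonal_smul]
      rfl
    calc ∏ i, (1 + s * (w i ^ (1 / p) * w i ^ (1 / p) * lam i))
        = ∏ i, (1 + w i ^ (1 / p) * w i ^ (1 / p) * (s * lam i)) :=
          Finset.prod_congr rfl fun i _ => by ring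
      _ ≤ _ := key
      _ = (1 + Matrix.diagonal (fun i => w i ^ (1 / p)) *
            (Matrix.diagonal (fun i => w i ^ (1 / p)) * (s • (Qᵀ * K * Q)))).det := by
          rw [← mul_assoc (Matrix.diagonal _) (Matrix.diagonal _),
            Matrix.diagonal_mul_diagonal, hlam, hVK]
          simp [Matrix.transpose_mul, mul_assoc]
      _ = _ := by
          rw [Matrix.det_one_add_mul_comm]
          simp [mul_assoc]
end

section
/- Fix positive integers m, n, q, d̃ with d̃ ≤ n, and define r̃ := min{o : C(o+q,q) ≥ d̃}; assume r̃ ≤ m. Consider matrices X ∈ ℝ^{m×n} of the form X = U V where U ∈ ℝ^{m×r̃} and V ∈ ℝ^{r̃×n}, i.e., rank(X) ≤ r̃. The set of such matrices is parametrized (up to the GL(r̃) gauge freedom V ↦ G V, U ↦ U G^{-1}) by (m − r̃)·r̃ + n·r̃ real parameters when d̃ is replaced by r̃; more generally, the dimension of the manifold of m×n matrices X such that rank(φ(X)) = d̃ for a q-order polynomial feature map φ is at most (m − r̃)·d̃ + n·r̃. -/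
open scoped Matrix

/-- A `q`-order polynomial feature map on `ℝ^m`: coordinates are indexed by (a type in
bijection with) the multi-indices `ν` with `|ν| ≤ q`, and the coordinate for `ν` is
`c · x^ν` with a nonzero constant `c`. -/
def IsPolyFeatureMap {m : ℕ} {ι : Type} (q : ℕ) (φ : (Fin m → ℝ) → ι → ℝ) : Prop :=
  ∃ e : ι ≃ {ν : Fin m →₀ ℕ // ν.sum (fun _ t => t) ≤ q}, ∃ c : ι → ℝ,
    (∀ i, c i ≠ 0) ∧
    ∀ x i, φ x i = c i * ((e i : Fin m →₀ ℕ).prod fun k t => x k ^ t)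

open scoped Topology

/-- A germ that is `C¹` at a point extends to a global `C¹` function. -/
theorem ContDiffAt.exists_contDiff_eventuallyEq {E F : Type*} [NormedAddCommGroup E]
    [NormedSpace ℝ E] [FiniteDimensional ℝ E] [NormedAddCommGroup F] [NormedSpace ℝ F]
    {g : E → F} {a : E} (hg : ContDiffAt ℝ 1 g a) :
    ∃ G : E → F, ContDiff ℝ 1 G ∧ G =ᶠ[𝓝 a] g := by
  have h := hg.eventually (by simp)
  obtain ⟨ε, hε, hb⟩ := Metric.nhds_basis_closedBall.eventually_iff.1 h
  let f : ContDiffBump a := ⟨ε / 2, ε, by positivity, by linarith⟩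
  refine ⟨fun x => f x • g x, contDiff_iff_contDiffAt.2 fun x => ?_, ?_⟩
  · by_cases hx : x ∈ tsupport f
    · rw [f.tsupport_eq] at hx
      exact f.contDiffAt.smul (hb hx)
    · have hx0 : (fun z => f z • g z) =ᶠ[𝓝 x] fun _ => 0 := by
        filter_upwards [notMem_tsupport_iff_eventuallyEq.1 hx] with z hz
        simp [hz]
      exact contDiffAt_const.congr_of_eventuallyEq hx0
  · filter_upwards [f.eventuallyEq_one] with x hx
    simp [hx]

/-- The simple zeros `(t, y)` (in `y`) of a `C¹` function lie on countably many global `C¹`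
graphs. -/
theorem exists_countable_contDiff_graphs {E : Type*} [NormedAddCommGroup E]
    [NormedSpace ℝ E] [FiniteDimensional ℝ E] (f : E × ℝ → ℝ) (hf : ContDiff ℝ 1 f) :
    ∃ S : Set (E → ℝ), S.Countable ∧ (∀ g ∈ S, ContDiff ℝ 1 g) ∧
      ∀ t y, f (t, y) = 0 → deriv (fun z => f (t, z)) y ≠ 0 → ∃ g ∈ S, g t = y := by
  have : CompleteSpace E := FiniteDimensional.complete ℝ E
  let Z : Set (E × ℝ) := {p | f p = 0 ∧ deriv (fun z => f (p.1, z)) p.2 ≠ 0}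
  have key : ∀ p ∈ Z, ∃ g : E → ℝ, ContDiff ℝ 1 g ∧
      ∀ᶠ v in 𝓝 p, f v = 0 → g v.1 = v.2 := by
    rintro p ⟨hp0, hp1⟩
    have cdf : ContDiffAt ℝ 1 f p := hf.contDiffAt
    have hinv : (fderiv ℝ f p ∘L .inr ℝ E ℝ).IsInvertible := by
      have hd : HasDerivAt (fun z => f (p.1, z)) ((fderiv ℝ f p ∘L .inr ℝ E ℝ) 1) p.2 := by
        have h1 : HasFDerivAt f (fderiv ℝ f p) (p.1, p.2) :=
          (hf.differentiable (by simp) p).hasFDerivAt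
        exact (h1.comp p.2 (hasFDerivAt_prodMk_right p.1 p.2)).hasDerivAt
      rw [hd.deriv] at hp1
      refine ⟨ContinuousLinearEquiv.unitsEquivAut ℝ (Units.mk0 _ hp1), ?_⟩
      ext
      simp
    obtain ⟨G, hG, hGe⟩ :=
      (cdf.contDiffAt_implicitFunction one_ne_zero hinv).exists_contDiff_eventuallyEq
    refine ⟨G, hG, ?_⟩
    filter_upwards [cdf.eventually_apply_eq_iff_implicitFunction one_ne_zero hinv,
      continuous_fst.continuousAt.eventually hGe] with v hv hv' h0
    rw [hv', hv.1 (h0.trans hp0.symm)]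
  choose! g hg hgv using key
  obtain ⟨T, hTZ, hT, hcov⟩ := TopologicalSpace.countable_cover_nhdsWithin
    (s := Z) (f := fun p => {v | f v = 0 → g p v.1 = v.2})
    fun p hp => mem_nhdsWithin_of_mem_nhds (hgv p hp)
  refine ⟨g '' T, hT.image g, ?_, fun t y h0 h1 => ?_⟩
  · rintro _ ⟨p, hp, rfl⟩
    exact hg p (hTZ hp)
  · obtain ⟨p, hp, hv⟩ := Set.mem_iUnion₂.1 (hcov (show (t, y) ∈ Z from ⟨h0, h1⟩))
    exact ⟨g p, ⟨p, hp, rfl⟩, hv h0⟩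

/-- In characteristic zero, an algebraic element is a simple root of some polynomial. -/
theorem IsAlgebraic.exists_aeval_derivative_ne_zero {A K : Type*} [CommRing A] [IsDomain A]
    [CharZero A] [CommRing K] [Algebra A K] [FaithfulSMul A K] {y : K} (hy : IsAlgebraic A y) :
    ∃ p : Polynomial A, Polynomial.aeval y p = 0 ∧ Polynomial.aeval y p.derivative ≠ 0 := by
  classical
  obtain ⟨p₀, hp₀, hy₀⟩ := hy
  have hex : ∃ d, ∃ p : Polynomial A, p ≠ 0 ∧ Polynomial.aeval y p = 0 ∧ p.natDegree = d :=
    ⟨_, p₀, hp₀, hy₀, rfl⟩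
  obtain ⟨p, hp, hyp, hd⟩ := Nat.find_spec hex
  have hpos : p.natDegree ≠ 0 := by
    intro h
    rw [Polynomial.eq_C_of_natDegree_eq_zero h, Polynomial.aeval_C,
      FaithfulSMul.algebraMap_eq_zero_iff] at hyp
    exact hp (by rw [Polynomial.eq_C_of_natDegree_eq_zero h, hyp, map_zero])
  refine ⟨p, hyp, fun h => ?_⟩
  refine Nat.find_min hex (m := p.derivative.natDegree) ?_ ⟨_, ?_, h, rfl⟩
  · exact (Polynomial.natDegree_derivative_lt hpos).trans_eq hd
  · intro h0
    exact hpos (Polynomial.derivative_eq_zero.1 h0)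

/-- Countably many global `C¹` functions on `ℝ^σ` suffice to produce every real number that is
algebraic over the coordinates of a point. -/
theorem exists_countable_contDiff_algebraic (σ : Type) [Fintype σ] :
    ∃ S : Set ((σ → ℝ) → ℝ), S.Countable ∧ (∀ g ∈ S, ContDiff ℝ 1 g) ∧
      ∀ t y, IsAlgebraic (Algebra.adjoin ℚ (Set.range t)) y → ∃ g ∈ S, g t = y := by
  let ev (t : σ → ℝ) : MvPolynomial σ ℚ →+* ℝ := (MvPolynomial.aeval t : _ →ₐ[ℚ] ℝ)
  let f (P : Polynomial (MvPolynomial σ ℚ)) (v : (σ → ℝ) × ℝ) : ℝ := P.eval₂ (ev v.1) v.2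
  have hmv : ∀ p : MvPolynomial σ ℚ, ContDiff ℝ 1 fun v : (σ → ℝ) × ℝ => ev v.1 p := by
    intro p
    induction p using MvPolynomial.induction_on with
    | C a => simpa [ev] using contDiff_const
    | add p q hp hq => simpa using hp.add hq
    | mul_X p i hp =>
      simp only [ev, map_mul, RingHom.coe_coe, MvPolynomial.aeval_X] at hp ⊢
      exact hp.mul (by fun_prop)
  have hf : ∀ P, ContDiff ℝ 1 (f P) := by
    intro P
    simp only [f, Polynomial.eval₂_eq_sum, Polynomial.sum]
    exact ContDiff.sum fun i _ => (hmv _).mul (contDiff_snd.pow _)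
  have hder : ∀ P t y, deriv (fun z => f P (t, z)) y = P.derivative.eval₂ (ev t) y := by
    intro P t y
    simp only [f, Polynomial.eval₂_eq_eval_map]
    rw [Polynomial.deriv, ← Polynomial.derivative_map]
  choose S hS hSg hSt using fun P => exists_countable_contDiff_graphs (f P) (hf P)
  have : Countable (Polynomial (MvPolynomial σ ℚ)) := by
    rw [← Cardinal.mk_le_aleph0_iff]
    refine Polynomial.cardinalMk_le_max.trans
      (max_le (MvPolynomial.cardinalMk_le_max.trans ?_) le_rfl)
    simp
  refine ⟨⋃ P, S P, Set.countable_iUnion hS, ?_, fun t y hy => ?_⟩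
  · intro g hg
    obtain ⟨P, hP⟩ := Set.mem_iUnion.1 hg
    exact hSg P g hP
  · obtain ⟨p, hp, hp'⟩ := hy.exists_aeval_derivative_ne_zero
    have hmem : ∀ q, MvPolynomial.aeval t q ∈ Algebra.adjoin ℚ (Set.range t) := fun q => by
      rw [Algebra.adjoin_range_eq_range_aeval]; exact ⟨q, rfl⟩
    let e : MvPolynomial σ ℚ →+* Algebra.adjoin ℚ (Set.range t) :=
      ((MvPolynomial.aeval t : _ →ₐ[ℚ] ℝ).codRestrict _ hmem : _ →ₐ[ℚ] _)
    have he : Function.Surjective e := by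
      rintro ⟨z, hz⟩
      have hz' := hz
      rw [Algebra.adjoin_range_eq_range_aeval] at hz'
      obtain ⟨q, hq⟩ := hz'
      exact ⟨q, Subtype.ext hq⟩
    obtain ⟨P, rfl⟩ := Polynomial.map_surjective e he p
    have hcomp : (algebraMap (Algebra.adjoin ℚ (Set.range t)) ℝ).comp e = ev t := rfl
    obtain ⟨g, hg, hgt⟩ := hSt P t y
      (by simpa [Polynomial.aeval_def, Polynomial.eval₂_map, hcomp] using hp)
      (by rw [hder]; simpa [Polynomial.aeval_def, Polynomial.derivative_map,
            Polynomial.eval₂_map, hcomp] using hp')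
    exact ⟨g, Set.mem_iUnion.2 ⟨P, hg⟩, hgt⟩


theorem IsAlgebraic.of_range_algebraMap_subset {R R' K : Type*} [CommRing R] [CommRing R']
    [CommRing K] [Algebra R K] [Algebra R' K] [FaithfulSMul R K]
    (h : Set.range (algebraMap R K) ⊆ Set.range (algebraMap R' K)) {y : K}
    (hy : IsAlgebraic R y) : IsAlgebraic R' y := by
  obtain ⟨p, hp, hpy⟩ := hy
  obtain ⟨q, hq⟩ : p.map (algebraMap R K) ∈ Polynomial.lifts (algebraMap R' K) := by
    rw [Polynomial.lifts_iff_coeff_lifts]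
    intro k
    rw [Polynomial.coeff_map]
    exact h ⟨_, rfl⟩
  replace hq : q.map (algebraMap R' K) = p.map (algebraMap R K) := hq
  refine ⟨q, ?_, ?_⟩
  · rintro rfl
    rw [Polynomial.map_zero, eq_comm, Polynomial.map_eq_zero_iff
      (FaithfulSMul.algebraMap_injective R K)] at hq
    exact hp hq
  · rwa [← Polynomial.aeval_map_algebraMap K, hq, Polynomial.aeval_map_algebraMap]

theorem IsAlgebraic.adjoin_mono {R K : Type*} [CommRing R] [CommRing K] [Algebra R K]
    {s t : Set K} (h : s ⊆ t) {y : K}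
    (hy : IsAlgebraic (Algebra.adjoin R s) y) : IsAlgebraic (Algebra.adjoin R t) y :=
  hy.of_range_algebraMap_subset (by
    rintro _ ⟨z, rfl⟩
    exact ⟨⟨z, Algebra.adjoin_mono h z.2⟩, rfl⟩)

theorem IsAlgebraic.adjoin_union_of_adjoin_adjoin {R K : Type*} [CommRing R] [CommRing K]
    [Algebra R K] {s t : Set K} {y : K}
    (hy : IsAlgebraic (Algebra.adjoin (Algebra.adjoin R s) t) y) :
    IsAlgebraic (Algebra.adjoin R (s ∪ t)) y :=
  hy.of_range_algebraMap_subset (by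
    rintro _ ⟨z, rfl⟩
    refine ⟨⟨z, ?_⟩, rfl⟩
    rw [Algebra.adjoin_union_eq_adjoin_adjoin]
    exact z.2)

theorem AlgebraicIndependent.linearIndependent_finsupp_prod {R A ι : Type*} [CommRing R]
    [CommRing A] [Algebra R A] {x : ι → A} (hx : AlgebraicIndependent R x) :
    LinearIndependent R fun ν : ι →₀ ℕ => ν.prod fun i e => x i ^ e := by
  have h := (MvPolynomial.basisMonomials ι R).linearIndependent.map'
    (MvPolynomial.aeval x).toLinearMap (LinearMap.ker_eq_bot.2 hx)
  have heq : (MvPolynomial.aeval x).toLinearMap ∘ MvPolynomial.basisMonomials ι R =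
      fun ν : ι →₀ ℕ => ν.prod fun i e => x i ^ e := by
    ext ν
    simp [MvPolynomial.aeval_monomial]
  rwa [heq] at h

/-- There are `(|ι| + q).choose q` distinct multi-indices of degree at most `q`. -/
theorem exists_injective_degree_le (ι : Type*) [Fintype ι] (q : ℕ) :
    ∃ f : Fin ((Fintype.card ι + q).choose q) → (ι →₀ ℕ), Function.Injective f ∧
      ∀ k, (f k).sum (fun _ t => t) ≤ q := by
  classical
  let f (s : Sym (Option ι) q) : ι →₀ ℕ := (Multiset.toFinsupp (s : Multiset (Option ι))).some
  have hsum (s : Sym (Option ι) q) :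
      (s : Multiset (Option ι)).count none + (f s).sum (fun _ t => t) = q := by
    have h1 := Finsupp.sum_option_index (Multiset.toFinsupp (s : Multiset (Option ι)))
      (fun _ t => t) (fun _ => rfl) (fun _ _ _ => rfl)
    have h2 := Multiset.toFinsupp_sum_eq (s : Multiset (Option ι))
    rw [Sym.card_coe] at h2
    refine Eq.trans ?_ (h1.symm.trans h2)
    simp [f]
  have hf : Function.Injective f := by
    intro s t hst
    apply Sym.coe_injective
    ext o
    cases o with
    | none =>
      have h1 := hsum s
      have h2 := hsum t
      rw [hst] at h1
      omega
    | some i =>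
      simpa [f] using DFunLike.congr_fun hst i
  have hcard : Fintype.card (Sym (Option ι) q) = (Fintype.card ι + q).choose q := by
    rw [Sym.card_sym_eq_choose, Fintype.card_option,
      show Fintype.card ι + 1 + q - 1 = Fintype.card ι + q by omega]
  let e := (Fintype.equivFinOfCardEq hcard).symm
  refine ⟨f ∘ e, hf.comp e.injective, fun k => ?_⟩
  have := hsum (e k)
  simp only [Function.comp]
  omega

/-- If every column of `x` has at most `r` entries algebraically independent over the entries of the
columns in `J`, then all entries are algebraic over `m * |J| + (n - |J|) * r` of them. -/
theorem exists_finset_isAlgebraic {m n : ℕ} (x : Fin m × Fin n → ℝ) (J : Finset (Fin n)) (r : ℕ)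
    (h : ∀ j, ∀ T : Finset (Fin m),
      AlgebraicIndepOn (Algebra.adjoin ℚ (x '' (Finset.univ ×ˢ J : Finset (Fin m × Fin n))))
        (fun i => x (i, j)) T → T.card ≤ r) :
    ∃ B : Finset (Fin m × Fin n), B.card ≤ m * J.card + (n - J.card) * r ∧
      ∀ p, IsAlgebraic (Algebra.adjoin ℚ (x '' B)) (x p) := by
  classical
  set A := Algebra.adjoin ℚ (x '' (Finset.univ ×ˢ J : Finset (Fin m × Fin n))) with hA
  have hmax : ∀ j, ∃ T : Finset (Fin m),
      Maximal (fun T : Finset (Fin m) => AlgebraicIndepOn A (fun i => x (i, j)) T) T := by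
    intro j
    obtain ⟨T, -, hT⟩ := (Set.toFinite {T : Finset (Fin m) |
      AlgebraicIndepOn A (fun i => x (i, j)) T}).exists_le_maximal (a := ∅) (by
        have : IsEmpty ((∅ : Finset (Fin m)) : Set (Fin m)) := by simp
        exact algebraicIndependent_empty_type_iff.2 Subtype.val_injective)
    exact ⟨T, hT⟩
  choose T hT using hmax
  refine ⟨Finset.univ ×ˢ J ∪ Jᶜ.biUnion fun j => T j ×ˢ {j}, ?_, ?_⟩
  · refine (Finset.card_union_le _ _).trans (add_le_add ?_ ?_)
    · simp
    · refine (Finset.card_biUnion_le_card_mul _ _ r fun j _ => ?_).trans ?_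
      · simpa using h j _ (hT j).prop
      · simp [Finset.card_compl]
  · rintro ⟨i, j⟩
    by_cases hj : j ∈ J
    · exact isAlgebraic_algebraMap (⟨x (i, j), Algebra.subset_adjoin ⟨(i, j), by simp [hj], rfl⟩⟩ :
        Algebra.adjoin ℚ (x '' _))
    · have halg : IsAlgebraic (Algebra.adjoin A ((fun i => x (i, j)) '' T j)) (x (i, j)) := by
        by_contra hn
        have hins := (hT j).prop.insert hn
        have hi : i ∈ T j := (hT j).2 (y := insert i (T j)) (by simpa using hins)
          (Finset.subset_insert _ _) (Finset.mem_insert_self _ _)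
        exact hn (isAlgebraic_algebraMap (⟨_, Algebra.subset_adjoin ⟨i, hi, rfl⟩⟩ :
          Algebra.adjoin A ((fun i => x (i, j)) '' T j)))
      refine halg.adjoin_union_of_adjoin_adjoin.adjoin_mono ?_
      rintro _ (⟨p, hp, rfl⟩ | ⟨k, hk, rfl⟩)
      · exact ⟨p, Finset.mem_union_left _ hp, rfl⟩
      · refine ⟨(k, j), Finset.mem_union_right _ ?_, rfl⟩
        simpa [hj] using hk

theorem Matrix.exists_finset_card_eq_rank {ι κ : Type*} [Finite ι] [Fintype κ]
    (M : Matrix ι κ ℝ) :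
    ∃ J : Finset κ, J.card = M.rank ∧ ∀ j, ∃ c : J → ℝ, ∀ i, M i j = ∑ l, c l * M i l := by
  classical
  obtain ⟨J, -, -, hJ, hli⟩ := exists_linearIndepOn_extension (K := ℝ) (v := M.col)
    (linearIndepOn_empty ℝ M.col) (Set.empty_subset Set.univ)
  obtain ⟨J, rfl⟩ := J.toFinite.exists_finset_coe
  have hspan : Submodule.span ℝ (Set.range M.col) = Submodule.span ℝ (M.col '' J) := by
    refine le_antisymm (Submodule.span_le.2 ?_) (Submodule.span_mono (Set.image_subset_range _ _))
    rwa [← Set.image_univ]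
  refine ⟨J, ?_, fun j => ?_⟩
  · rw [Matrix.rank_eq_finrank_span_cols, hspan, Set.image_eq_range]
    simpa using (finrank_span_eq_card hli.linearIndependent).symm
  · obtain ⟨c, hc⟩ := (Submodule.mem_span_image_finset_iff_exists_fun ℝ).1
      (hJ ⟨j, Set.mem_univ j, rfl⟩)
    refine ⟨c, fun i => ?_⟩
    have := congrFun hc i
    simpa [Finset.sum_apply] using this.symm

theorem LinearIndependent.card_le_of_mem_span_range {R M κ ι : Type*} [CommRing R] [Nontrivial R]
    [AddCommGroup M] [Module R M] [Fintype κ] [Fintype ι] {v : κ → M}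
    (hv : LinearIndependent R v) (c : ι → M) (h : ∀ k, v k ∈ Submodule.span R (Set.range c)) :
    Fintype.card κ ≤ Fintype.card ι := by
  classical
  have h1 := linearIndependent_le_span' v hv (Set.range c) (by
    rintro _ ⟨k, rfl⟩
    exact h k)
  rw [Cardinal.mk_fintype, Nat.cast_le] at h1
  exact h1.trans (Fintype.card_range_le c)

theorem le_of_choose_add_le_choose_add {k r q : ℕ} (hq : 0 < q)
    (h : (k + q).choose q ≤ (r + q).choose q) : k ≤ r := by
  by_contra! hlt
  have h1 : (r + 1 + q).choose q ≤ (k + q).choose q := Nat.choose_le_choose q (by omega)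
  obtain ⟨p, rfl⟩ := Nat.exists_eq_succ_of_ne_zero hq.ne'
  have h2 : (r + 1 + (p + 1)).choose (p + 1) =
      (r + (p + 1)).choose p + (r + (p + 1)).choose (p + 1) := by
    rw [show r + 1 + (p + 1) = (r + (p + 1)) + 1 by omega, Nat.choose_succ_succ]
  have h3 : 0 < (r + (p + 1)).choose p := Nat.choose_pos (by omega)
  simp only [Nat.succ_eq_add_one] at *
  omega

theorem succ_le_choose_add (o : ℕ) {q : ℕ} (hq : 0 < q) : o + 1 ≤ (o + q).choose q := by
  rw [← Nat.choose_symm_add]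
  calc o + 1 = (o + 1).choose o := by simp
    _ ≤ _ := Nat.choose_le_choose o (by omega)

/-- A set of matrices, each with entries algebraic over at most `N` of them, is covered by countably
many `C¹` images of `ℝ^N`. -/
theorem exists_countable_contDiff_cover {m n N : ℕ} (P : Set (Matrix (Fin m) (Fin n) ℝ))
    (h : ∀ X ∈ P, ∃ B : Finset (Fin m × Fin n), B.card ≤ N ∧
      ∀ p, IsAlgebraic (Algebra.adjoin ℚ ((fun p : Fin m × Fin n => X p.1 p.2) '' B))
        (X (Prod.fst p) (Prod.snd p))) :
    ∃ (κ : Type) (_ : Countable κ) (F : κ → (Fin N → ℝ) → (Fin m → Fin n → ℝ)),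
      (∀ i, ContDiff ℝ 1 (F i)) ∧ P ⊆ ⋃ i, {X | ∃ u, ∀ a b, X a b = F i u a b} := by
  obtain ⟨S, hS, hSc, hSa⟩ := exists_countable_contDiff_algebraic (Fin N)
  have := hS.to_subtype
  refine ⟨Fin m × Fin n → S, inferInstance, fun k u a b => (k (a, b)).1 u, fun k => ?_, ?_⟩
  · exact contDiff_pi.2 fun a => contDiff_pi.2 fun b => hSc _ (k (a, b)).2
  · intro X hX
    obtain ⟨B, hB, hBa⟩ := h X hX
    let t (i : Fin N) : ℝ :=
      if hi : i < B.card then X (B.equivFin.symm ⟨i, hi⟩).1.1 (B.equivFin.symm ⟨i, hi⟩).1.2 else 0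
    have ht : (fun p : Fin m × Fin n => X p.1 p.2) '' B ⊆ Set.range t := by
      rintro _ ⟨p, hp, rfl⟩
      refine ⟨Fin.castLE hB (B.equivFin ⟨p, hp⟩), ?_⟩
      simp [t]
    choose g hg hgt using fun p => hSa t _ ((hBa p).adjoin_mono ht)
    exact Set.mem_iUnion.2 ⟨fun p => ⟨g p, hg p⟩, t, fun a b => (hgt (a, b)).symm⟩

theorem card_bound_eq {m n r s : ℕ} (hr : r ≤ m) (hs : s ≤ n) :
    m * s + (n - s) * r = (m - r) * s + n * r := by
  obtain ⟨a, rfl⟩ := Nat.exists_eq_add_of_le hr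
  obtain ⟨b, rfl⟩ := Nat.exists_eq_add_of_le hs
  simp only [Nat.add_sub_cancel_left]
  ring

theorem card_bound_mono {m n r s : ℕ} (hsr : s ≤ r) (hm : r ≤ m) (hn : r ≤ n) :
    m * s + (n - s) * s ≤ (m - r) * r + n * r := by
  rw [card_bound_eq (hsr.trans hm) (hsr.trans hn)]
  obtain ⟨a, rfl⟩ := Nat.exists_eq_add_of_le hm
  obtain ⟨b, rfl⟩ := Nat.exists_eq_add_of_le hn
  obtain ⟨c, rfl⟩ := Nat.exists_eq_add_of_le hsr
  rw [show s + c + a - s = c + a by omega, show s + c + a - (s + c) = a by omega]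
  nlinarith [Nat.zero_le (c * a), Nat.zero_le (c * b)]

theorem Submodule.sum_mul_mem_span_range {R K ι : Type*} [CommRing R] [CommRing K] [Algebra R K]
    [Fintype ι] (S : Subalgebra R K) (c a : ι → K) (ha : ∀ l, a l ∈ S) :
    ∑ l, c l * a l ∈ Submodule.span S (Set.range c) := by
  refine Submodule.sum_mem _ fun l _ => ?_
  have h := Submodule.smul_mem (Submodule.span S (Set.range c)) (⟨a l, ha l⟩ : S)
    (Submodule.subset_span ⟨l, rfl⟩)
  rwa [Subalgebra.smul_def, smul_eq_mul, mul_comm] at h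

theorem exists_finset_isAlgebraic_of_rank {m n r : ℕ} (X : Matrix (Fin m) (Fin n) ℝ)
    (hX : X.rank ≤ r) (hm : r ≤ m) (hn : r ≤ n) :
    ∃ B : Finset (Fin m × Fin n), B.card ≤ (m - r) * r + n * r ∧
      ∀ p, IsAlgebraic (Algebra.adjoin ℚ ((fun p : Fin m × Fin n => X p.1 p.2) '' B))
        (X (Prod.fst p) (Prod.snd p)) := by
  obtain ⟨J, hJ, hc⟩ := X.exists_finset_card_eq_rank
  obtain ⟨B, hB, hBa⟩ := exists_finset_isAlgebraic (fun p : Fin m × Fin n => X p.1 p.2) J J.card (by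
    intro j T hT
    obtain ⟨c, hc⟩ := hc j
    have hli := AlgebraicIndependent.linearIndependent hT
    have := hli.card_le_of_mem_span_range c fun i => by
      have hi := hc i
      simp only [hi]
      exact Submodule.sum_mul_mem_span_range _ c _ fun l =>
        Algebra.subset_adjoin ⟨(i, l), by simp, rfl⟩
    simpa using this)
  exact ⟨B, hB.trans (card_bound_mono (hJ.trans_le hX) hm hn), hBa⟩

theorem exists_finset_isAlgebraic_of_rank_featureMap {m n q d r : ℕ} (hq : 0 < q)
    (hd : d ≤ (r + q).choose q) (hdn : d ≤ n) (hm : r ≤ m) {ι : Type} [Fintype ι]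
    {φ : (Fin m → ℝ) → ι → ℝ} (hφ : IsPolyFeatureMap q φ) (X : Matrix (Fin m) (Fin n) ℝ)
    (hX : (Matrix.of fun i j => φ (fun t => X t j) i : Matrix ι (Fin n) ℝ).rank = d) :
    ∃ B : Finset (Fin m × Fin n), B.card ≤ (m - r) * d + n * r ∧
      ∀ p, IsAlgebraic (Algebra.adjoin ℚ ((fun p : Fin m × Fin n => X p.1 p.2) '' B))
        (X (Prod.fst p) (Prod.snd p)) := by
  obtain ⟨J, hJ, hc⟩ := Matrix.exists_finset_card_eq_rank
    (Matrix.of fun i j => φ (fun t => X t j) i : Matrix ι (Fin n) ℝ)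
  obtain ⟨e, w, hw, hφ⟩ := hφ
  rw [hX] at hJ
  obtain ⟨B, hB, hBa⟩ := exists_finset_isAlgebraic (fun p : Fin m × Fin n => X p.1 p.2) J r (by
    intro j T hT
    obtain ⟨c, hc⟩ := hc j
    obtain ⟨f, hf, hfq⟩ := exists_injective_degree_le T q
    have hli := (AlgebraicIndependent.linearIndependent_finsupp_prod hT).comp f hf
    have hmem := hli.card_le_of_mem_span_range c fun k => by
      let ν : Fin m →₀ ℕ := (f k).embDomain (Function.Embedding.subtype _)
      have hν : ν.sum (fun _ t => t) ≤ q := by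
        rw [Finsupp.sum_embDomain]
        exact hfq k
      have hi := hc (e.symm ⟨ν, hν⟩)
      simp only [Matrix.of_apply, hφ, Equiv.apply_symm_apply] at hi
      have hi' : (ν.prod fun s t => X s j ^ t) =
          ∑ l : J, c l * ν.prod fun s t => X s l ^ t := by
        refine mul_left_cancel₀ (hw (e.symm ⟨ν, hν⟩)) ?_
        rw [hi, Finset.mul_sum]
        exact Finset.sum_congr rfl fun l _ => by ring
      have hprod : (ν.prod fun s t => X s j ^ t) = (f k).prod fun i t => X i j ^ t :=
        Finsupp.prod_embDomain
      rw [hprod] at hi'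
      simp only [Function.comp_apply]
      refine (congrArg (· ∈ _) hi').mpr (Submodule.sum_mul_mem_span_range _ c _ fun l => ?_)
      refine Subalgebra.prod_mem _ fun s _ => Subalgebra.pow_mem _ ?_ _
      exact Algebra.subset_adjoin ⟨(s, l), by simp, rfl⟩
    simp only [Fintype.card_fin, Fintype.card_coe, hJ] at hmem
    refine le_of_choose_add_le_choose_add hq ((Eq.le ?_).trans (hmem.trans hd))
    simp)
  rw [hJ, card_bound_eq hm hdn] at hB
  exact ⟨B, hB, hBa⟩

/-- with `r̃ := min {o : C(o+q,q) ≥ d̃} ≤ m`, (1) the set of matrices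
`X = U·V` of rank ≤ r̃ is covered by countably many images of `C¹` maps from a parameter
space of dimension `(m−r̃)·r̃ + n·r̃`; (2) the set of `X` with `rank φ(X) = d̃` for a
`q`-order polynomial feature map `φ` is covered by countably many images of `C¹` maps
from a parameter space of dimension `(m−r̃)·d̃ + n·r̃`. -/
theorem stmt8 (m n q dt : ℕ) (hm : 0 < m) (hn : 0 < n) (hq : 0 < q) (hdt : 0 < dt)
    (hdn : dt ≤ n)
    (rt : ℕ) (hrt : rt = sInf {o : ℕ | dt ≤ (o + q).choose q}) (hrm : rt ≤ m) :
    (∃ (κ : Type) (_ : Countable κ)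
      (F : κ → (Fin ((m - rt) * rt + n * rt) → ℝ) → (Fin m → Fin n → ℝ)),
      (∀ i, ContDiff ℝ 1 (F i)) ∧
      {X : Matrix (Fin m) (Fin n) ℝ |
          ∃ (U : Matrix (Fin m) (Fin rt) ℝ) (V : Matrix (Fin rt) (Fin n) ℝ), X = U * V}
        ⊆ ⋃ i, {X | ∃ u, ∀ a b, X a b = F i u a b}) ∧
    (∀ (ι : Type) (_ : Fintype ι) (_ : DecidableEq ι)
      (φ : (Fin m → ℝ) → ι → ℝ), IsPolyFeatureMap q φ →
      ∃ (κ : Type) (_ : Countable κ)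
        (F : κ → (Fin ((m - rt) * dt + n * rt) → ℝ) → (Fin m → Fin n → ℝ)),
        (∀ i, ContDiff ℝ 1 (F i)) ∧
        {X : Matrix (Fin m) (Fin n) ℝ |
            (Matrix.of fun i j => φ (fun t => X t j) i : Matrix ι (Fin n) ℝ).rank = dt}
          ⊆ ⋃ i, {X | ∃ u, ∀ a b, X a b = F i u a b}) := by
  have hd : dt ≤ (rt + q).choose q := by
    have hne : {o : ℕ | dt ≤ (o + q).choose q}.Nonempty :=
      ⟨dt, (Nat.le_succ dt).trans (succ_le_choose_add dt hq)⟩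
    rw [hrt]
    exact Nat.sInf_mem hne
  have hrn : rt ≤ n := by
    refine le_trans ?_ hdn
    rw [hrt]
    exact Nat.sInf_le ((Nat.le_succ dt).trans (succ_le_choose_add dt hq))
  constructor
  · apply exists_countable_contDiff_cover
    rintro X ⟨U, V, rfl⟩
    refine exists_finset_isAlgebraic_of_rank _ ?_ hrm hrn
    exact (Matrix.rank_mul_le_left U V).trans (by simpa using U.rank_le_card_width)
  · intro ι _ _ φ hφ
    apply exists_countable_contDiff_cover
    intro X hX
    exact exists_finset_isAlgebraic_of_rank_featureMap hq hd hdn hrm hφ X hX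
end
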